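/- Let K and K̃ be invertible real n×n matrices and let 0 ≤ η < 1 be such that ‖K̃⁻¹b − K⁻¹b‖₂ ≤ η · ‖K⁻¹b‖₂ for every b ∈ ℝⁿ, and let Q be a real symmetric positive definite n×n matrix with largest eigenvalue λ_max(Q) and smallest eigenvalue λ_min(Q). Then, with κ = λ_max(Q)/λ_min(Q), for every nonzero y ∈ ℝⁿ one has κ⁻¹ · (1−η)² ≤ ⟨K Q⁻¹ Kᵀ y, y⟩ / ⟨K̃ Q⁻¹ K̃ᵀ y, y⟩ ≤ κ · (1+η)². -/

import Mathlib

open Matrix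

/-- The Euclidean norm on `ℝⁿ`. -/
noncomputable def eNorm {n : ℕ} (x : Fin n → ℝ) : ℝ := Real.sqrt (x ⬝ᵥ x)

theorem eNorm_eq_norm {n : ℕ} (x : Fin n → ℝ) : eNorm x = ‖WithLp.toLp 2 x‖ := by
  rw [eNorm, EuclideanSpace.norm_eq]
  simp [dotProduct, sq]

theorem eNorm_nonneg {n : ℕ} (x : Fin n → ℝ) : 0 ≤ eNorm x := Real.sqrt_nonneg _

theorem eNorm_sq {n : ℕ} (x : Fin n → ℝ) : eNorm x ^ 2 = x ⬝ᵥ x :=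
  Real.sq_sqrt (Finset.sum_nonneg fun i _ => mul_self_nonneg (x i))

theorem eNorm_add_le {n : ℕ} (x y : Fin n → ℝ) : eNorm (x + y) ≤ eNorm x + eNorm y := by
  simp only [eNorm_eq_norm]
  exact norm_add_le (WithLp.toLp 2 x) (WithLp.toLp 2 y)

theorem eNorm_sub_comm {n : ℕ} (x y : Fin n → ℝ) : eNorm (x - y) = eNorm (y - x) := by
  simp only [eNorm_eq_norm]
  exact norm_sub_rev (WithLp.toLp 2 x) (WithLp.toLp 2 y)

theorem dotProduct_le_eNorm_mul_eNorm {n : ℕ} (x y : Fin n → ℝ) :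
    x ⬝ᵥ y ≤ eNorm x * eNorm y := by
  simp only [eNorm_eq_norm]
  have h := real_inner_le_norm (WithLp.toLp 2 x) (WithLp.toLp 2 y)
  simpa [PiLp.inner_apply, dotProduct, mul_comm] using h

theorem eNorm_transpose_mulVec_le {n : ℕ} {M : Matrix (Fin n) (Fin n) ℝ} {η : ℝ}
    (hM : ∀ v, eNorm (M *ᵥ v) ≤ η * eNorm v) (w : Fin n → ℝ) :
    eNorm (Mᵀ *ᵥ w) ≤ η * eNorm w := by
  have h1 : eNorm (Mᵀ *ᵥ w) ^ 2 ≤ (η * eNorm (Mᵀ *ᵥ w)) * eNorm w := by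
    have h : (Mᵀ *ᵥ w) ⬝ᵥ (Mᵀ *ᵥ w) = (M *ᵥ (Mᵀ *ᵥ w)) ⬝ᵥ w := by
      conv_lhs => rw [dotProduct_mulVec, vecMul_transpose]
    rw [eNorm_sq, h]
    exact (dotProduct_le_eNorm_mul_eNorm _ _).trans
      (mul_le_mul_of_nonneg_right (hM _) (eNorm_nonneg w))
  rcases (eNorm_nonneg (Mᵀ *ᵥ w)).eq_or_lt with h0 | h0
  · have h2 := (eNorm_nonneg _).trans (hM w)
    rwa [← h0]
  · nlinarith

theorem exists_diagonal_form {n : ℕ} {Q : Matrix (Fin n) (Fin n) ℝ} (hQ : Q.IsHermitian)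
    (v : Fin n → ℝ) : ∃ z : Fin n → ℝ,
      (Q *ᵥ v) ⬝ᵥ v = ∑ i, hQ.eigenvalues i * z i ^ 2 ∧
      (Q *ᵥ v) ⬝ᵥ (Q *ᵥ v) = ∑ i, hQ.eigenvalues i ^ 2 * z i ^ 2 := by
  let U : Matrix (Fin n) (Fin n) ℝ := hQ.eigenvectorUnitary
  have hU : Uᵀ * U = 1 := by
    simpa [star_eq_conjTranspose] using Unitary.coe_star_mul_self hQ.eigenvectorUnitary
  have hQU : Q = U * diagonal hQ.eigenvalues * Uᵀ := by
    simpa [Unitary.conjStarAlgAut_apply, star_eq_conjTranspose, Function.comp_def]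
      using hQ.spectral_theorem
  have hmul : ∀ a b : Fin n → ℝ, (U *ᵥ a) ⬝ᵥ b = a ⬝ᵥ (Uᵀ *ᵥ b) := fun a b => by
    rw [dotProduct_mulVec, vecMul_transpose]
  have hQv : Q *ᵥ v = U *ᵥ (diagonal hQ.eigenvalues *ᵥ (Uᵀ *ᵥ v)) := by
    conv_lhs => rw [hQU]
    simp only [mulVec_mulVec, Matrix.mul_assoc]
  refine ⟨Uᵀ *ᵥ v, ?_, ?_⟩
  · rw [hQv, hmul]
    simp only [dotProduct, mulVec_diagonal]
    exact Finset.sum_congr rfl fun i _ => by ring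
  · rw [hQv, hmul, mulVec_mulVec _ Uᵀ U, hU, one_mulVec]
    simp only [dotProduct, mulVec_diagonal]
    exact Finset.sum_congr rfl fun i _ => by ring

theorem inv_quadratic_form_bounds {n : ℕ} {Q : Matrix (Fin n) (Fin n) ℝ} (hQ : Q.PosDef)
    {lmax lmin : ℝ} (hmax : ∀ i, hQ.1.eigenvalues i ≤ lmax)
    (hmin : ∀ i, lmin ≤ hQ.1.eigenvalues i) (u : Fin n → ℝ) :
    lmin * ((Q⁻¹ *ᵥ u) ⬝ᵥ u) ≤ eNorm u ^ 2 ∧ eNorm u ^ 2 ≤ lmax * ((Q⁻¹ *ᵥ u) ⬝ᵥ u) := by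
  obtain ⟨z, h1, h2⟩ := exists_diagonal_form hQ.1 (Q⁻¹ *ᵥ u)
  have hu : Q *ᵥ (Q⁻¹ *ᵥ u) = u := by
    rw [mulVec_mulVec, mul_nonsing_inv _ ((isUnit_iff_isUnit_det _).1 hQ.isUnit), one_mulVec]
  rw [hu] at h1 h2
  rw [eNorm_sq, dotProduct_comm (Q⁻¹ *ᵥ u), h1, h2, Finset.mul_sum, Finset.mul_sum]
  have hp : ∀ i, 0 ≤ hQ.1.eigenvalues i * z i ^ 2 := fun i =>
    mul_nonneg (hQ.eigenvalues_pos i).le (sq_nonneg _)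
  constructor <;> refine Finset.sum_le_sum fun i _ => ?_
  · nlinarith [mul_le_mul_of_nonneg_right (hmin i) (hp i)]
  · nlinarith [mul_le_mul_of_nonneg_right (hmax i) (hp i)]

/-- **Scaled Braess–Peisker conditions.**
If `K, K̃` are invertible with `‖K̃⁻¹ b − K⁻¹ b‖₂ ≤ η ‖K⁻¹ b‖₂` for all `b`
(`0 ≤ η < 1`), and `Q` is symmetric positive definite with largest eigenvalue
`lmax` and smallest eigenvalue `lmin`, then with `κ = lmax / lmin`, for every
nonzero `y` we have
`κ⁻¹ (1−η)² ≤ ⟨K Q⁻¹ Kᵀ y, y⟩ / ⟨K̃ Q⁻¹ K̃ᵀ y, y⟩ ≤ κ (1+η)²`. -/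
theorem braess_peisker_scaled {n : ℕ} (K Kt Q : Matrix (Fin n) (Fin n) ℝ)
    (hK : IsUnit K.det) (hKt : IsUnit Kt.det)
    (η : ℝ) (hη0 : 0 ≤ η) (hη1 : η < 1)
    (happrox : ∀ b : Fin n → ℝ,
      eNorm (Kt⁻¹ *ᵥ b - K⁻¹ *ᵥ b) ≤ η * eNorm (K⁻¹ *ᵥ b))
    (hQ : Q.PosDef)
    (lmax lmin : ℝ)
    (hlmax : IsGreatest (Set.range hQ.1.eigenvalues) lmax)
    (hlmin : IsLeast (Set.range hQ.1.eigenvalues) lmin)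
    (y : Fin n → ℝ) (hy : y ≠ 0) :
    (lmax / lmin)⁻¹ * (1 - η) ^ 2 ≤
      (((K * Q⁻¹ * Kᵀ) *ᵥ y) ⬝ᵥ y) / (((Kt * Q⁻¹ * Ktᵀ) *ᵥ y) ⬝ᵥ y) ∧
    (((K * Q⁻¹ * Kᵀ) *ᵥ y) ⬝ᵥ y) / (((Kt * Q⁻¹ * Ktᵀ) *ᵥ y) ⬝ᵥ y) ≤
      (lmax / lmin) * (1 + η) ^ 2 := by
  have hpert : ∀ v, eNorm ((Kt⁻¹ * K - 1) *ᵥ v) ≤ η * eNorm v := fun v => by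
    have h := happrox (K *ᵥ v)
    rwa [mulVec_mulVec, mulVec_mulVec, nonsing_inv_mul _ hK, ← sub_mulVec, one_mulVec] at h
  have hdiff : eNorm (Kᵀ *ᵥ y - Ktᵀ *ᵥ y) ≤ η * eNorm (Ktᵀ *ᵥ y) := by
    have h := eNorm_transpose_mulVec_le hpert (Ktᵀ *ᵥ y)
    rwa [mulVec_mulVec, ← transpose_mul, Matrix.mul_sub, mul_nonsing_inv_cancel_left _ _ hKt,
      Matrix.mul_one, transpose_sub, sub_mulVec] at h
  have hform : ∀ A : Matrix (Fin n) (Fin n) ℝ,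
      ((A * Q⁻¹ * Aᵀ) *ᵥ y) ⬝ᵥ y = (Q⁻¹ *ᵥ (Aᵀ *ᵥ y)) ⬝ᵥ (Aᵀ *ᵥ y) := fun A => by
    rw [dotProduct_mulVec, vecMul_transpose]
    simp only [mulVec_mulVec, Matrix.mul_assoc]
  have hw : Ktᵀ *ᵥ y ≠ 0 := fun h => hy <| by
    have h' := congrArg (fun x => (Ktᵀ)⁻¹ *ᵥ x) h
    simpa [mulVec_mulVec, nonsing_inv_mul _ (isUnit_det_transpose Kt hKt)] using h'
  rw [hform, hform]
  generalize Kᵀ *ᵥ y = u at *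
  generalize Ktᵀ *ᵥ y = w at *
  have hupper : eNorm u ≤ (1 + η) * eNorm w := by
    have h := eNorm_add_le (u - w) w
    rw [sub_add_cancel] at h
    linarith
  have hlower : (1 - η) * eNorm w ≤ eNorm u := by
    have h := eNorm_add_le (w - u) u
    rw [sub_add_cancel, eNorm_sub_comm] at h
    linarith
  have hmax : ∀ i, hQ.1.eigenvalues i ≤ lmax := fun i => hlmax.2 ⟨i, rfl⟩
  have hmin : ∀ i, lmin ≤ hQ.1.eigenvalues i := fun i => hlmin.2 ⟨i, rfl⟩
  have hlmin_pos : 0 < lmin := by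
    obtain ⟨i, rfl⟩ := hlmin.1
    exact hQ.eigenvalues_pos i
  have hlmax_pos : 0 < lmax := hlmin_pos.trans_le (hlmin.2 hlmax.1)
  obtain ⟨hu1, hu2⟩ := inv_quadratic_form_bounds hQ hmax hmin u
  obtain ⟨hw1, hw2⟩ := inv_quadratic_form_bounds hQ hmax hmin w
  have hwpos : 0 < (Q⁻¹ *ᵥ w) ⬝ᵥ w := by
    have h : 0 < w ⬝ᵥ (Q⁻¹ *ᵥ w) := by simpa using hQ.inv.dotProduct_mulVec_pos hw
    rwa [dotProduct_comm]
  have hupper_sq : eNorm u ^ 2 ≤ (1 + η) ^ 2 * eNorm w ^ 2 := by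
    rw [← mul_pow]
    exact pow_le_pow_left₀ (eNorm_nonneg u) hupper 2
  have hlower_sq : (1 - η) ^ 2 * eNorm w ^ 2 ≤ eNorm u ^ 2 := by
    rw [← mul_pow]
    exact pow_le_pow_left₀ (mul_nonneg (by linarith) (eNorm_nonneg w)) hlower 2
  constructor
  · rw [le_div_iff₀ hwpos, inv_div, div_mul_eq_mul_div, div_mul_eq_mul_div,
      div_le_iff₀ hlmax_pos]
    calc lmin * (1 - η) ^ 2 * ((Q⁻¹ *ᵥ w) ⬝ᵥ w)
        = (1 - η) ^ 2 * (lmin * ((Q⁻¹ *ᵥ w) ⬝ᵥ w)) := by ring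
      _ ≤ (1 - η) ^ 2 * eNorm w ^ 2 := by gcongr
      _ ≤ eNorm u ^ 2 := hlower_sq
      _ ≤ ((Q⁻¹ *ᵥ u) ⬝ᵥ u) * lmax := by linarith
  · rw [div_le_iff₀ hwpos, div_mul_eq_mul_div, div_mul_eq_mul_div, le_div_iff₀ hlmin_pos]
    calc ((Q⁻¹ *ᵥ u) ⬝ᵥ u) * lmin
        ≤ eNorm u ^ 2 := by linarith
      _ ≤ (1 + η) ^ 2 * eNorm w ^ 2 := hupper_sq
      _ ≤ (1 + η) ^ 2 * (lmax * ((Q⁻¹ *ᵥ w) ⬝ᵥ w)) := by gcongr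
      _ = lmax * (1 + η) ^ 2 * ((Q⁻¹ *ᵥ w) ⬝ᵥ w) := by ring
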